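/- arXiv:2002.03477 — 3 statements merged into one kernel-verified Lean document; each statement's English description precedes it below -/
import Mathlib

section
/- Quantum Donoho–Stark support uncertainty principle on a fusion ring: Let N, * be a fusion ring of rank m with Perron–Frobenius dimensions d_j. For every nonzero x ∈ ℂ^m, S_A(x) · S_B(F(x)) ≥ 1, where S_A(x) = Σ_{j : x_j ≠ 0} d_j² and S_B(F(x)) = τ(P), with P the orthogonal projection of ℂ^m onto the column space (range) of the matrix F(x). -/
open Matrix in
/-- A projection whose range contains the range of `Y` fixes `Y` under left multiplication. -/
theorem Matrix.mul_eq_of_range_mulVecLin_le {n R : Type*} [Fintype n] [DecidableEq n] [CommRing R]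
    {P Y : Matrix n n R} (hP : P * P = P)
    (h : LinearMap.range Y.mulVecLin ≤ LinearMap.range P.mulVecLin) : P * Y = Y := by
  refine Matrix.ext_of_mulVec_single fun i => ?_
  obtain ⟨v, hv⟩ := h ⟨Pi.single i 1, rfl⟩
  simp only [mulVecLin_apply] at hv
  rw [← mulVec_mulVec, ← hv, mulVec_mulVec, hP]

open Matrix in
/-- If `P * Y = Y` for a Hermitian idempotent `P`, then the square norm of the `i`-th row of `Y`
is at most `‖Y‖ ^ 2 * P i i`. -/
theorem Matrix.sum_norm_sq_row_le {n : Type*} [Fintype n] [DecidableEq n]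
    {P Y : Matrix n n ℂ} (hP : P * P = P) (hP' : Pᴴ = P) (h : P * Y = Y) (i : n) :
    ∑ t, ‖Y i t‖ ^ 2 ≤ ‖toEuclideanCLM (𝕜 := ℂ) Y‖ ^ 2 * (P i i).re := by
  have hPn : ∑ t, ‖P t i‖ ^ 2 = (P i i).re := by
    have h₁ : (Pᴴ * P) i i = P i i := by rw [hP', hP]
    rw [← h₁, mul_apply, Complex.re_sum]
    refine Finset.sum_congr rfl fun t _ => ?_
    rw [conjTranspose_apply, Complex.star_def, Complex.conj_mul']
    norm_cast
  have hY : Yᴴ *ᵥ (fun t => P t i) = fun t => star (Y i t) := by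
    have h₁ : Yᴴ * P = Yᴴ := by rw [← hP', ← conjTranspose_mul, h]
    ext t
    exact congr_fun (congr_fun h₁ t) i
  have hle := (toEuclideanCLM (𝕜 := ℂ) Yᴴ).le_opNorm (WithLp.toLp 2 fun t => P t i)
  rw [toEuclideanCLM_toLp, hY] at hle
  have hn : ‖toEuclideanCLM (𝕜 := ℂ) Yᴴ‖ = ‖toEuclideanCLM (𝕜 := ℂ) Y‖ := by
    rw [← star_eq_conjTranspose, map_star, ContinuousLinearMap.star_eq_adjoint,
      LinearIsometryEquiv.norm_map]
  rw [hn] at hle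
  have hsq := pow_le_pow_left₀ (norm_nonneg _) hle 2
  rw [mul_pow, EuclideanSpace.norm_sq_eq, EuclideanSpace.norm_sq_eq] at hsq
  simpa only [norm_star, hPn] using hsq

open scoped Classical in
/-- The square norm of a linear combination is controlled by the norms of the vectors that occur
in it. -/
theorem norm_sum_smul_sq_le {ι E : Type*} [Fintype ι] [SeminormedAddCommGroup E]
    [NormedSpace ℂ E] (x : ι → ℂ) (v : ι → E) :
    ‖∑ j, x j • v j‖ ^ 2 ≤
      (∑ j ∈ Finset.univ.filter (fun j => x j ≠ 0), ‖v j‖ ^ 2) * ∑ j, ‖x j‖ ^ 2 := by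
  have hsmul : ∑ j ∈ Finset.univ.filter (fun j => x j ≠ 0), x j • v j = ∑ j, x j • v j :=
    Finset.sum_filter_of_ne fun j _ => mt fun h => by simp [h]
  have hsq : ∑ j ∈ Finset.univ.filter (fun j => x j ≠ 0), ‖x j‖ ^ 2 = ∑ j, ‖x j‖ ^ 2 :=
    Finset.sum_filter_of_ne fun j _ => mt fun h => by simp [h]
  rw [← hsmul, ← hsq]
  refine (pow_le_pow_left₀ (norm_nonneg _) (norm_sum_le _ _) 2).trans ?_
  simp only [norm_smul, mul_comm ‖x _‖]
  exact Finset.sum_mul_sq_le_sq_mul_sq _ _ _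


open scoped Classical in
open Finset Matrix in
/-- Quantum Donoho–Stark support uncertainty principle on a fusion ring: for every
nonzero `x`, `S_A(x) · S_B(F(x)) ≥ 1`, where `S_A(x) = Σ_{j : x_j ≠ 0} d_j²` and
`S_B(F(x)) = τ(P)` with `P` the orthogonal projection (Hermitian idempotent) onto
the column space of the matrix `F(x) = Σ_j x_j M_j`. -/
theorem fusionRing_donoho_stark
    (m : ℕ) [NeZero m]
    (N : Fin m → Fin m → Fin m → ℕ) (st : Fin m → Fin m)
    (h_inv : ∀ j, st (st j) = j)
    (h_unit_left : ∀ k s, N 0 k s = if k = s then 1 else 0)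
    (h_unit_right : ∀ k s, N k 0 s = if k = s then 1 else 0)
    (h_assoc : ∀ j k l s, ∑ t, N j k t * N t l s = ∑ t, N k l t * N j t s)
    (h_dual : ∀ j k, N j k 0 = if j = st k then 1 else 0)
    (h_anti : ∀ j k s, N j k s = N (st k) (st j) (st s))
    (M : Fin m → Matrix (Fin m) (Fin m) ℂ)
    (hM : ∀ j s t, M j s t = (N j s t : ℂ))
    (d : Fin m → ℝ)
    (hd_pos : ∀ j, 0 < d j)
    (hd : ∀ j, d j = ‖Matrix.toEuclideanCLM (𝕜 := ℂ) (M j)‖)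
    (x : Fin m → ℂ) (hx : x ≠ 0)
    (P : Matrix (Fin m) (Fin m) ℂ)
    (hP_idem : P * P = P)
    (hP_herm : Pᴴ = P)
    (hP_range : LinearMap.range P.mulVecLin = LinearMap.range (∑ j, x j • M j).mulVecLin) :
    1 ≤ (∑ j ∈ Finset.univ.filter (fun j => x j ≠ 0), (d j) ^ 2) * (P 0 0).re := by
  set Y := ∑ j, x j • M j with hYdef
  have hrow (t : Fin m) : Y 0 t = x t := by
    simp [hYdef, Matrix.sum_apply, hM, h_unit_right]
  have hx_pos : 0 < ∑ t, ‖x t‖ ^ 2 := by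
    obtain ⟨t, ht⟩ := Function.ne_iff.mp hx
    exact Finset.sum_pos' (fun _ _ => by positivity)
      ⟨t, Finset.mem_univ t, by have := norm_pos_iff.mpr ht; positivity⟩
  have hlower := Matrix.sum_norm_sq_row_le hP_idem hP_herm
    (Matrix.mul_eq_of_range_mulVecLin_le hP_idem hP_range.ge) 0
  simp only [hrow] at hlower
  have hupper := norm_sum_smul_sq_le x fun j => Matrix.toEuclideanCLM (𝕜 := ℂ) (M j)
  simp only [← map_smul, ← map_sum, ← hYdef, ← hd] at hupper
  have hP_nonneg : 0 ≤ (P 0 0).re := by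
    by_contra! hneg
    nlinarith [mul_nonneg (sq_nonneg ‖Matrix.toEuclideanCLM (𝕜 := ℂ) Y‖) (neg_nonneg.mpr hneg.le)]
  refine le_of_mul_le_mul_right ?_ hx_pos
  calc 1 * ∑ t, ‖x t‖ ^ 2 ≤ ‖Matrix.toEuclideanCLM (𝕜 := ℂ) Y‖ ^ 2 * (P 0 0).re := by
        rwa [one_mul]
    _ ≤ _ := mul_le_mul_of_nonneg_right hupper hP_nonneg
    _ = _ := by ring
end

section
/- The Perron–Frobenius dimension is a ring homomorphism on a fusion ring: Let N, * be a fusion ring of rank m and let d_j > 0 be the Perron–Frobenius dimension of the j-th basis element, i.e. the operator norm (largest eigenvalue) of the fusion matrix M_j. Then the vector d⃗ = (d_1, …, d_m) satisfies M_j · d⃗ = d_j · d⃗ for every j; equivalently d_j · d_k = Σ_s N_{j,k}^s · d_s for all j, k. Moreover d_{j*} = d_j and d_1 = 1. -/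
section NonnegativeMatrices

open Matrix

variable {n : Type*} [Fintype n]

lemma mulVec_pos_of_nonneg_of_ne_zero {A : Matrix n n ℝ} (hA : ∀ i j, 0 < A i j) {v : n → ℝ}
    (hv : ∀ i, 0 ≤ v i) (hv0 : v ≠ 0) (i : n) : 0 < (A *ᵥ v) i := by
  obtain ⟨k, hk⟩ := Function.ne_iff.mp hv0
  exact Finset.sum_pos' (fun j _ => mul_nonneg (hA i j).le (hv j))
    ⟨k, Finset.mem_univ k, mul_pos (hA i k) (lt_of_le_of_ne (hv k) (Ne.symm hk))⟩

/-- A symmetric matrix with nonnegative entries has a nonzero nonnegative eigenvector. -/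
lemma exists_nonneg_eigenvector_of_isSymm [DecidableEq n] [Nonempty n] {A : Matrix n n ℝ}
    (hA : ∀ i j, 0 ≤ A i j) (hsymm : A.IsSymm) :
    ∃ (v : n → ℝ) (r : ℝ), (∀ i, 0 ≤ v i) ∧ v ≠ 0 ∧ A *ᵥ v = r • v := by
  set T := toEuclideanCLM (n := n) (𝕜 := ℝ) A with hT
  have hsa : IsSelfAdjoint T := by
    have : IsSelfAdjoint A := by
      rw [IsSelfAdjoint, star_eq_conjTranspose, conjTranspose_eq_transpose_of_trivial]
      exact hsymm
    exact this.map _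
  have hT_inner (x : EuclideanSpace ℝ n) :
      T.reApplyInnerSelf x = ∑ i, ∑ j, x i * (A i j * x j) := by
    rw [ContinuousLinearMap.reApplyInnerSelf_apply, real_inner_comm, hT, inner_toEuclideanCLM]
    simp [dotProduct, mulVec, Finset.mul_sum]
  obtain ⟨x, hx, hmax⟩ := (isCompact_sphere (0 : EuclideanSpace ℝ n) 1).exists_isMaxOn
    (NormedSpace.sphere_nonempty.mpr zero_le_one) T.reApplyInnerSelf_continuous.continuousOn
  let y : EuclideanSpace ℝ n := WithLp.toLp 2 fun i => |x i|
  have hy_norm : ‖y‖ = 1 := by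
    have hx1 : ‖x‖ = 1 := by simpa using hx
    rw [← hx1, ← sq_eq_sq₀ (norm_nonneg _) (norm_nonneg _), EuclideanSpace.real_norm_sq_eq,
      EuclideanSpace.real_norm_sq_eq]
    simp [y]
  have hxy : T.reApplyInnerSelf x ≤ T.reApplyInnerSelf y := by
    rw [hT_inner, hT_inner]
    refine Finset.sum_le_sum fun i _ => Finset.sum_le_sum fun j _ => ?_
    calc x i * (A i j * x j) ≤ |x i * (A i j * x j)| := le_abs_self _
      _ = |x i| * (A i j * |x j|) := by rw [abs_mul, abs_mul, abs_of_nonneg (hA i j)]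
  have hy0 : y ≠ 0 := by
    intro h
    simp [h] at hy_norm
  have hy_max : IsMaxOn T.reApplyInnerSelf (Metric.sphere 0 ‖y‖) y := by
    rw [hy_norm]
    exact fun z hz => (hmax hz).trans hxy
  obtain ⟨r, hr⟩ : ∃ r : ℝ, T y = r • y :=
    ⟨_, (hsa.hasEigenvector_of_isMaxOn hy0 hy_max).apply_eq_smul⟩
  refine ⟨y.ofLp, r, fun i => abs_nonneg (x i), fun h => hy0 (WithLp.ofLp_injective 2 h),
    congrArg WithLp.ofLp hr⟩

/-- **Perron's theorem** for symmetric matrices with positive entries. -/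
lemma exists_pos_eigenvector_of_isSymm [DecidableEq n] [Nonempty n] {A : Matrix n n ℝ}
    (hA : ∀ i j, 0 < A i j) (hsymm : A.IsSymm) :
    ∃ (v : n → ℝ) (r : ℝ), (∀ i, 0 < v i) ∧ A *ᵥ v = r • v ∧
      ∀ w, A *ᵥ w = r • w → ∃ c : ℝ, w = c • v := by
  obtain ⟨v, r, hv, hv0, hvr⟩ := exists_nonneg_eigenvector_of_isSymm (fun i j => (hA i j).le) hsymm
  have hv_pos (i : n) : 0 < v i := by
    have h := mulVec_pos_of_nonneg_of_ne_zero hA hv hv0 i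
    rw [hvr, Pi.smul_apply, smul_eq_mul] at h
    exact lt_of_le_of_ne (hv i) fun h0 => by simp [← h0] at h
  refine ⟨v, r, hv_pos, hvr, fun w hw => ?_⟩
  obtain ⟨k, hk⟩ := Finite.exists_min fun i => w i / v i
  refine ⟨w k / v k, ?_⟩
  by_contra hne
  have h := mulVec_pos_of_nonneg_of_ne_zero hA (v := w - (w k / v k) • v)
    (fun i => by simpa [← le_div_iff₀ (hv_pos i)] using hk i) (sub_ne_zero.mpr hne) k
  rw [mulVec_sub, mulVec_smul, hw, hvr] at h
  have hvk := (hv_pos k).ne'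
  simp only [Pi.sub_apply, Pi.smul_apply, smul_eq_mul] at h
  field_simp at h
  simp at h

/-- **Schur's test**: a nonnegative matrix having a positive vector as a common eigenvector with
itself and its transpose, for the same eigenvalue, has that eigenvalue as its operator norm. -/
lemma norm_toEuclideanCLM_eq_of_pos_eigenvector [DecidableEq n] [Nonempty n] {A : Matrix n n ℝ}
    (hA : ∀ i j, 0 ≤ A i j) {v : n → ℝ} (hv : ∀ i, 0 < v i) {c : ℝ} (h : A *ᵥ v = c • v)
    (h' : Aᵀ *ᵥ v = c • v) : ‖toEuclideanCLM (n := n) (𝕜 := ℝ) A‖ = c := by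
  have hrow (i : n) : ∑ j, A i j * v j = c * v i := congrFun h i
  have hcol (j : n) : ∑ i, A i j * v i = c * v j := congrFun h' j
  have hc : 0 ≤ c := by
    obtain ⟨i⟩ := ‹Nonempty n›
    refine nonneg_of_mul_nonneg_left ?_ (hv i)
    rw [← hrow i]
    exact Finset.sum_nonneg fun j _ => mul_nonneg (hA i j) (hv j).le
  apply le_antisymm
  · refine ContinuousLinearMap.opNorm_le_bound _ hc fun x => ?_
    rw [← sq_le_sq₀ (norm_nonneg _) (by positivity), mul_pow, EuclideanSpace.real_norm_sq_eq,
      EuclideanSpace.real_norm_sq_eq, ofLp_toEuclideanCLM]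
    calc ∑ i, (A *ᵥ x.ofLp) i ^ 2
        ≤ ∑ i, (∑ j, A i j * v j) * ∑ j, A i j * (x j ^ 2 / v j) := by
          refine Finset.sum_le_sum fun i _ => Finset.sum_sq_le_sum_mul_sum_of_sq_le_mul _
            (fun j _ => mul_nonneg (hA i j) (hv j).le)
            (fun j _ => mul_nonneg (hA i j) (div_nonneg (sq_nonneg _) (hv j).le))
            fun j _ => le_of_eq ?_
          have := (hv j).ne'
          field_simp
      _ = ∑ j, c * (x j ^ 2 / v j) * ∑ i, A i j * v i := by
          simp only [hrow, Finset.mul_sum]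
          rw [Finset.sum_comm]
          exact Finset.sum_congr rfl fun j _ => Finset.sum_congr rfl fun i _ => by ring
      _ = c ^ 2 * ∑ j, x j ^ 2 := by
          rw [Finset.mul_sum]
          refine Finset.sum_congr rfl fun j _ => ?_
          have := (hv j).ne'
          rw [hcol]
          field_simp
  · have hv0 : (WithLp.toLp 2 v : EuclideanSpace ℝ n) ≠ 0 := by
      obtain ⟨i⟩ := ‹Nonempty n›
      exact fun h0 => (hv i).ne' (congrFun (congrArg WithLp.ofLp h0) i)
    have hle := (toEuclideanCLM (n := n) (𝕜 := ℝ) A).le_opNorm (WithLp.toLp 2 v)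
    rw [toEuclideanCLM_toLp, h, WithLp.toLp_smul, norm_smul, Real.norm_of_nonneg hc] at hle
    exact le_of_mul_le_mul_right hle (norm_pos_iff.mpr hv0)

lemma eigenvalue_transpose_eq [Nonempty n] {A : Matrix n n ℝ} {v : n → ℝ} (hv : ∀ i, 0 < v i)
    {a b : ℝ} (ha : A *ᵥ v = a • v) (hb : Aᵀ *ᵥ v = b • v) : a = b := by
  have hvv : 0 < v ⬝ᵥ v :=
    Finset.sum_pos (fun i _ => mul_pos (hv i) (hv i)) Finset.univ_nonempty
  have h : v ⬝ᵥ (A *ᵥ v) = (Aᵀ *ᵥ v) ⬝ᵥ v := by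
    rw [dotProduct_mulVec, mulVec_transpose]
  rw [ha, hb, dotProduct_smul, smul_dotProduct, smul_eq_mul, smul_eq_mul] at h
  exact mul_right_cancel₀ hvv.ne' h

end NonnegativeMatrices

section FusionCoefficients

variable {m : ℕ} [NeZero m] {N : Fin m → Fin m → Fin m → ℕ} {st : Fin m → Fin m}

lemma fusion_rotate (h_inv : ∀ j, st (st j) = j)
    (h_assoc : ∀ j k l s, ∑ t, N j k t * N t l s = ∑ t, N k l t * N j t s)
    (h_dual : ∀ j k, N j k 0 = if j = st k then 1 else 0) (j k l : Fin m) :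
    N j k (st l) = N k l (st j) := by
  have h := h_assoc j k l 0
  have hst (t : Fin m) : j = st t ↔ t = st j :=
    ⟨fun e => by rw [e, h_inv], fun e => by rw [e, h_inv]⟩
  simpa [h_dual, hst] using h

lemma fusion_transpose_left (h_inv : ∀ j, st (st j) = j)
    (h_assoc : ∀ j k l s, ∑ t, N j k t * N t l s = ∑ t, N k l t * N j t s)
    (h_dual : ∀ j k, N j k 0 = if j = st k then 1 else 0)
    (h_anti : ∀ j k s, N j k s = N (st k) (st j) (st s)) (j s t : Fin m) :
    N j s t = N (st j) t s := by
  have h₁ := fusion_rotate h_inv h_assoc h_dual j s (st t)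
  have h₂ := fusion_rotate h_inv h_assoc h_dual s (st t) j
  rw [h_inv] at h₁
  rw [h₁, h₂, h_anti, h_inv, h_inv]

lemma fusion_transpose_right (h_inv : ∀ j, st (st j) = j)
    (h_assoc : ∀ j k l s, ∑ t, N j k t * N t l s = ∑ t, N k l t * N j t s)
    (h_dual : ∀ j k, N j k 0 = if j = st k then 1 else 0)
    (h_anti : ∀ j k s, N j k s = N (st k) (st j) (st s)) (s k t : Fin m) :
    N s k t = N t (st k) s := by
  have h := fusion_rotate h_inv h_assoc h_dual s k (st t)
  rw [h_inv] at h
  rw [h, h_anti, h_inv, h_inv]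

/-- A fusion ring is transitive: every basis element occurs in some right multiple of any other. -/
lemma fusion_transitive (h_inv : ∀ j, st (st j) = j)
    (h_unit_left : ∀ k s, N 0 k s = if k = s then 1 else 0)
    (h_assoc : ∀ j k l s, ∑ t, N j k t * N t l s = ∑ t, N k l t * N j t s)
    (h_dual : ∀ j k, N j k 0 = if j = st k then 1 else 0) (s t : Fin m) :
    ∃ k, N s k t ≠ 0 := by
  by_contra! h
  have h₁ := h_assoc s (st s) t t
  have h₂ : ∑ r, N (st s) t r * N s r t = 0 :=
    Finset.sum_eq_zero fun r _ => by rw [h r, mul_zero]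
  rw [h₂, Finset.sum_eq_zero_iff] at h₁
  have h₃ := h₁ 0 (Finset.mem_univ _)
  simp [h_dual, h_unit_left, h_inv] at h₃

end FusionCoefficients


open Finset Matrix in
/-- The Perron–Frobenius dimension is a ring homomorphism on a fusion ring:
with `d_j` the operator norm of the fusion matrix `M_j`, the vector `d` satisfies
`M_j · d = d_j · d`, equivalently `d_j d_k = Σ_s N_{j,k}^s d_s`; moreover
`d_{j*} = d_j` and `d_1 = 1`. -/
theorem fusionRing_PF_dimension_hom
    (m : ℕ) [NeZero m]
    (N : Fin m → Fin m → Fin m → ℕ) (st : Fin m → Fin m)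
    (h_inv : ∀ j, st (st j) = j)
    (h_unit_left : ∀ k s, N 0 k s = if k = s then 1 else 0)
    (h_unit_right : ∀ k s, N k 0 s = if k = s then 1 else 0)
    (h_assoc : ∀ j k l s, ∑ t, N j k t * N t l s = ∑ t, N k l t * N j t s)
    (h_dual : ∀ j k, N j k 0 = if j = st k then 1 else 0)
    (h_anti : ∀ j k s, N j k s = N (st k) (st j) (st s))
    (M : Fin m → Matrix (Fin m) (Fin m) ℝ)
    (hM : ∀ j s t, M j s t = (N j s t : ℝ))
    (d : Fin m → ℝ)
    (hd_pos : ∀ j, 0 < d j)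
    (hd : ∀ j, d j = ‖Matrix.toEuclideanCLM (𝕜 := ℝ) (M j)‖) :
    (∀ j, (M j).mulVec d = d j • d) ∧
    (∀ j k, d j * d k = ∑ s, (N j k s : ℝ) * d s) ∧
    (∀ j, d (st j) = d j) ∧
    d 0 = 1 := by
  have hMT (j : Fin m) : (M j)ᵀ = M (st j) := by
    ext s t
    rw [transpose_apply, hM, hM, fusion_transpose_left h_inv h_assoc h_dual h_anti]
  let A : Matrix (Fin m) (Fin m) ℝ := of fun s t => ∑ k, (N s k t : ℝ)
  have hA_pos (s t : Fin m) : 0 < A s t := by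
    obtain ⟨k, hk⟩ := fusion_transitive h_inv h_unit_left h_assoc h_dual s t
    change 0 < ∑ k, (N s k t : ℝ)
    exact Finset.sum_pos' (fun _ _ => Nat.cast_nonneg _)
      ⟨k, Finset.mem_univ k, Nat.cast_pos.mpr (Nat.pos_of_ne_zero hk)⟩
  have hA_symm : A.IsSymm := by
    ext s t
    change ∑ k, (N t k s : ℝ) = ∑ k, (N s k t : ℝ)
    refine Fintype.sum_equiv (Function.Involutive.toPerm st h_inv) _ _ fun k => ?_
    rw [fusion_transpose_right h_inv h_assoc h_dual h_anti t k s]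
    rfl
  have hcomm (j : Fin m) : A * M j = M j * A := by
    ext l s
    simp only [Matrix.mul_apply, hM, A, of_apply, Finset.sum_mul, Finset.mul_sum]
    rw [Finset.sum_comm, Finset.sum_comm (s := Finset.univ (α := Fin m)) (t := Finset.univ)
      (f := fun t k => (N j l t : ℝ) * (N t k s : ℝ))]
    exact Finset.sum_congr rfl fun k _ => by exact_mod_cast (h_assoc j l k s).symm
  obtain ⟨v, r, hv, hvr, huniq⟩ := exists_pos_eigenvector_of_isSymm hA_pos hA_symm
  have heig (j : Fin m) : ∃ c : ℝ, M j *ᵥ v = c • v := by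
    apply huniq
    rw [mulVec_mulVec, hcomm, ← mulVec_mulVec, hvr, mulVec_smul]
  choose c hc using heig
  have hc_st (j : Fin m) : c (st j) = c j :=
    (eigenvalue_transpose_eq hv (hc j) (by rw [hMT, hc])).symm
  have hdc (j : Fin m) : d j = c j := by
    rw [hd]
    refine norm_toEuclideanCLM_eq_of_pos_eigenvector (fun s t => ?_) hv (hc j) ?_
    · rw [hM]
      exact Nat.cast_nonneg _
    · rw [hMT, hc, hc_st]
  obtain rfl : d = c := funext hdc
  have hprod (j k : Fin m) : M k * M j = ∑ t, (N j k t : ℝ) • M t := by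
    ext l s
    simp only [Matrix.mul_apply, Matrix.sum_apply, Matrix.smul_apply, smul_eq_mul, hM]
    exact_mod_cast (h_assoc j k l s).symm
  have hmul (j k : Fin m) : d j * d k = ∑ s, (N j k s : ℝ) * d s := by
    have h := congrFun (congrArg (· *ᵥ v) (hprod j k)) 0
    simp only [← mulVec_mulVec, hc, mulVec_smul, sum_mulVec, smul_mulVec, Finset.sum_apply,
      Pi.smul_apply, smul_eq_mul, ← mul_assoc, ← Finset.sum_mul] at h
    exact mul_right_cancel₀ (hv 0).ne' h
  refine ⟨fun j => funext fun k => ?_, hmul, hc_st, ?_⟩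
  · rw [Pi.smul_apply, smul_eq_mul, hmul]
    simp [mulVec, dotProduct, hM]
  · have h := hmul 0 0
    simp only [h_unit_left, Nat.cast_ite, Nat.cast_one, Nat.cast_zero, ite_mul, one_mul, zero_mul,
      Finset.sum_ite_eq, Finset.mem_univ, if_true] at h
    exact mul_right_cancel₀ (hd_pos 0).ne' (h.trans (one_mul _).symm)
end

section
/- Character table of the rank-7 example: Let ζ = exp(2πi/7) and let T be the 7×7 complex matrix with rows (1,1,1,1,1,1,1), (5,−1,−ζ−ζ⁶,−ζ⁵−ζ²,−ζ⁴−ζ³,0,0), (5,−1,−ζ⁵−ζ²,−ζ⁴−ζ³,−ζ−ζ⁶,0,0), (5,−1,−ζ⁴−ζ³,−ζ−ζ⁶,−ζ⁵−ζ²,0,0), (6,0,−1,−1,−1,1,1), (7,1,0,0,0,0,−3), (7,1,0,0,0,−1,2). Then for every j, c ∈ {1,…,7}, the c-th column of T is an eigenvector of the fusion matrix M_j (viewed over ℂ) with eigenvalue T_{j,c}: M_j · (T_{1,c}, …, T_{7,c})ᵀ = T_{j,c} · (T_{1,c}, …, T_{7,c})ᵀ. In particular the seven matrices are simultaneously diagonalizable,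 with the eigenvalues of M_j given by the j-th row of T. -/
def M₁ : Matrix (Fin 7) (Fin 7) ℂ := 1

def M₂ : Matrix (Fin 7) (Fin 7) ℂ :=
  !![0,1,0,0,0,0,0; 1,1,0,1,0,1,1; 0,0,1,0,1,1,1; 0,1,0,0,1,1,1;
     0,0,1,1,1,1,1; 0,1,1,1,1,1,1; 0,1,1,1,1,1,1]

def M₃ : Matrix (Fin 7) (Fin 7) ℂ :=
  !![0,0,1,0,0,0,0; 0,0,1,0,1,1,1; 1,1,1,0,0,1,1; 0,0,0,1,1,1,1;
     0,1,0,1,1,1,1; 0,1,1,1,1,1,1; 0,1,1,1,1,1,1]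

def M₄ : Matrix (Fin 7) (Fin 7) ℂ :=
  !![0,0,0,1,0,0,0; 0,1,0,0,1,1,1; 0,0,0,1,1,1,1; 1,0,1,1,0,1,1;
     0,1,1,0,1,1,1; 0,1,1,1,1,1,1; 0,1,1,1,1,1,1]

def M₅ : Matrix (Fin 7) (Fin 7) ℂ :=
  !![0,0,0,0,1,0,0; 0,0,1,1,1,1,1; 0,1,0,1,1,1,1; 0,1,1,0,1,1,1;
     1,1,1,1,1,1,1; 0,1,1,1,1,2,1; 0,1,1,1,1,1,2]

def M₆ : Matrix (Fin 7) (Fin 7) ℂ :=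
  !![0,0,0,0,0,1,0; 0,1,1,1,1,1,1; 0,1,1,1,1,1,1; 0,1,1,1,1,1,1;
     0,1,1,1,1,2,1; 1,1,1,1,2,0,3; 0,1,1,1,1,3,1]

def M₇ : Matrix (Fin 7) (Fin 7) ℂ :=
  !![0,0,0,0,0,0,1; 0,1,1,1,1,1,1; 0,1,1,1,1,1,1; 0,1,1,1,1,1,1;
     0,1,1,1,1,1,2; 0,1,1,1,1,3,1; 1,1,1,1,2,1,2]

/-- The seven fusion matrices of the rank-7 simple integral fusion ring. -/
def M : Fin 7 → Matrix (Fin 7) (Fin 7) ℂ := ![M₁, M₂, M₃, M₄, M₅, M₆, M₇]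

/-- `ζ = exp(2πi/7)`. -/
noncomputable def ζ : ℂ := Complex.exp (2 * Real.pi * Complex.I / 7)

/-- The character (eigenvalue) table of the rank-7 fusion ring. -/
noncomputable def T : Matrix (Fin 7) (Fin 7) ℂ :=
  !![1, 1, 1, 1, 1, 1, 1;
     5, -1, -ζ - ζ^6, -ζ^5 - ζ^2, -ζ^4 - ζ^3, 0, 0;
     5, -1, -ζ^5 - ζ^2, -ζ^4 - ζ^3, -ζ - ζ^6, 0, 0;
     5, -1, -ζ^4 - ζ^3, -ζ - ζ^6, -ζ^5 - ζ^2, 0, 0;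
     6, 0, -1, -1, -1, 1, 1;
     7, 1, 0, 0, 0, 0, -3;
     7, 1, 0, 0, 0, -1, 2]

theorem sum_range_pow_zeta_eq_zero : ∑ i ∈ Finset.range 7, ζ ^ i = 0 := by
  have h : IsPrimitiveRoot ζ 7 := by
    simpa [ζ] using Complex.isPrimitiveRoot_exp 7 (by norm_num)
  exact h.geom_sum_eq_zero (by norm_num)

set_option maxHeartbeats 1000000 in
open Matrix in
/-- Character table of the rank-7 example: for all `j, c`, the `c`-th column of `T`
is an eigenvector of the fusion matrix `M_j` with eigenvalue `T_{j,c}`. In particular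
the seven fusion matrices are simultaneously diagonalizable, the eigenvalues of `M_j`
being the `j`-th row of `T`. -/
theorem rank7_character_table :
    ∀ j c : Fin 7, (M j).mulVec (fun r => T r c) = T j c • (fun r => T r c) := by
  have h := sum_range_pow_zeta_eq_zero
  simp only [Finset.sum_range_succ, Finset.sum_range_zero] at h
  intro j c
  rcases eq_or_ne j 0 with rfl | hj
  · have hT : T 0 c = 1 := by fin_cases c <;> simp [T]
    simp [M, M₁, hT]
  ext r
  fin_cases j <;> try contradiction
  all_goals
    fin_cases c <;> fin_cases r <;>
      simp [M, M₂, M₃, M₄, M₅, M₆, M₇, T, Matrix.mulVec, dotProduct, Fin.sum_univ_seven] <;>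
      grind
end
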